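/- arXiv:1007.2217 — 6 statements merged into one kernel-verified Lean document; each statement's English description precedes it below -/
import Mathlib

section
/- For 0 < p < 1 and integer n ≥ 2, define MSE_NE(p) = (1-p)(2-p)/p², MSE_MME(n,p) = ((1-p)/p²)·(n/(n-1)), and MSE_LRE(n,p) = ((1-p)/p²)·((5n³+6n²-5n+6)/(5n(n²-1))). Then for every ε > 0 there exist N ∈ ℕ and p₀ ∈ (0,1) such that for all integers n ≥ N and all real p with 0 < p ≤ p₀, |MSE_MME(n,p)/MSE_NE(p) − 1/2| < ε and |MSE_LRE(n,p)/MSE_NE(p) − 1/2| < ε. -/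
/-- Mean squared error of the naive estimator of the host infection time. -/
noncomputable def MSE_NE (p : ℝ) : ℝ := (1 - p) * (2 - p) / p ^ 2

/-- Mean squared error of the method-of-moments estimator of the host infection time. -/
noncomputable def MSE_MME (n : ℕ) (p : ℝ) : ℝ := ((1 - p) / p ^ 2) * (n / (n - 1))

/-- Mean squared error of the linear regression estimator of the host infection time. -/
noncomputable def MSE_LRE (n : ℕ) (p : ℝ) : ℝ :=
  ((1 - p) / p ^ 2) *
    ((5 * (n : ℝ) ^ 3 + 6 * (n : ℝ) ^ 2 - 5 * (n : ℝ) + 6) / (5 * (n : ℝ) * ((n : ℝ) ^ 2 - 1)))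

lemma aux_ratio (p f ε : ℝ) (hp : 0 < p) (hp1 : p < 1) (hpe : p ≤ ε) (h1 : 1 ≤ f)
    (h2 : f ≤ 1 + ε / 2) :
    |((1 - p) / p ^ 2) * f / ((1 - p) * (2 - p) / p ^ 2) - 1 / 2| < ε := by
  have a : (1 - p) ≠ 0 := by linarith
  have b : (0:ℝ) < 2 - p := by linarith
  have e : ((1 - p) / p ^ 2) * f / ((1 - p) * (2 - p) / p ^ 2) - 1 / 2
      = (2 * (f - 1) + p) / (2 * (2 - p)) := by
    have b' := b.ne'
    field_simp
    ring
  rw [e, abs_of_nonneg (by apply div_nonneg <;> linarith), div_lt_iff₀ (by linarith)]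
  nlinarith

/-- For a sufficient number of hits and small hit probability, the MSE of the
method-of-moments and linear regression estimators is asymptotically half that of the
naive estimator. -/
theorem stmt_0 :
    ∀ ε : ℝ, 0 < ε → ∃ N : ℕ, ∃ p₀ : ℝ, 0 < p₀ ∧ p₀ < 1 ∧
      ∀ n : ℕ, N ≤ n → ∀ p : ℝ, 0 < p → p ≤ p₀ →
        |MSE_MME n p / MSE_NE p - 1 / 2| < ε ∧
        |MSE_LRE n p / MSE_NE p - 1 / 2| < ε := by
  intro ε hε
  obtain ⟨N, hN⟩ := exists_nat_gt (6 / ε)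
  refine ⟨N + 2, min (1 / 2) ε, by positivity,
    lt_of_le_of_lt (min_le_left _ _) (by norm_num), ?_⟩
  intro n hn p hp hp0
  have hp1 : p < 1 := lt_of_le_of_lt (hp0.trans (min_le_left _ _)) (by norm_num)
  have hpe : p ≤ ε := hp0.trans (min_le_right _ _)
  have hn' : (N : ℝ) + 2 ≤ n := by exact_mod_cast hn
  have hN0 : (0 : ℝ) ≤ N := Nat.cast_nonneg N
  rw [div_lt_iff₀ hε] at hN
  unfold MSE_MME MSE_LRE MSE_NE
  generalize (n : ℝ) = x at hn' ⊢
  have hx : 6 ≤ (x - 1) * ε := by nlinarith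
  have hx1 : 0 < x - 1 := by linarith
  have hD : 0 < 5 * x * (x ^ 2 - 1) := by
    have : 0 < x ^ 2 - 1 := by nlinarith
    have : 0 < x := by linarith
    positivity
  constructor
  · apply aux_ratio p _ ε hp hp1 hpe
    · rw [le_div_iff₀ hx1]; linarith
    · rw [div_le_iff₀ hx1]; nlinarith
  · apply aux_ratio p _ ε hp hp1 hpe
    · rw [le_div_iff₀ hD]; nlinarith
    · rw [div_le_iff₀ hD]
      have h3 : 0 ≤ ((x - 1) * ε - 6) * (5 * x * (x + 1)) :=
        mul_nonneg (by linarith) (by nlinarith)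
      nlinarith
end

section
/- Let X and Y be independent random variables where X has the exponential distribution with rate p_A and Y has the exponential distribution with rate p_B, with 0 < p_A < p_B. Then for every real τ > 0, P(X − Y > τ + 1/p_A − 1/p_B) = P(X − Y > τ)·exp(−(1 − p_A/p_B)). -/
open MeasureTheory ProbabilityTheory

lemma exp_tail {r : ℝ} (hr : 0 < r) {x : ℝ} (hx : 0 ≤ x) :
    expMeasure r (Set.Ioi x) = ENNReal.ofReal (Real.exp (-(r * x))) := by
  have := isProbabilityMeasure_expMeasure hr
  have h := cdf_expMeasure_eq hr x
  rw [if_pos hx, cdf_eq_real] at h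
  have h2 : (expMeasure r).real (Set.Ioi x) = Real.exp (-(r * x)) := by
    rw [← Set.compl_Iic, probReal_compl_eq_one_sub measurableSet_Iic, h]; ring
  rw [← h2, ofReal_measureReal]

lemma exp_ae_nonneg {r : ℝ} (hr : 0 < r) : ∀ᵐ y ∂(expMeasure r), 0 ≤ y := by
  have := isProbabilityMeasure_expMeasure hr
  have h := exp_tail hr le_rfl
  have h1 : ∀ᵐ y ∂(expMeasure r), y ∈ Set.Ioi (0:ℝ) := by
    refine (mem_ae_iff_prob_eq_one₀ measurableSet_Ioi.nullMeasurableSet).2 ?_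
    simpa using h
  filter_upwards [h1] with y hy using le_of_lt hy

/-- If `X` and `Y` are independent exponential random variables with rates `pA < pB`,
then for every `τ > 0`,
`P(X − Y > τ + 1/pA − 1/pB) = P(X − Y > τ)·exp(−(1 − pA/pB))`. -/
theorem stmt_1 {Ω : Type*} [MeasureSpace Ω] [IsProbabilityMeasure (ℙ : Measure Ω)]
    (pA pB : ℝ) (hA : 0 < pA) (hAB : pA < pB)
    (X Y : Ω → ℝ) (hX : Measurable X) (hY : Measurable Y)
    (hXY : IndepFun X Y ℙ)
    (hXd : Measure.map X ℙ = expMeasure pA)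
    (hYd : Measure.map Y ℙ = expMeasure pB) :
    ∀ τ : ℝ, 0 < τ →
      ℙ {ω | X ω - Y ω > τ + 1 / pA - 1 / pB} =
        ℙ {ω | X ω - Y ω > τ} * ENNReal.ofReal (Real.exp (-(1 - pA / pB))) := by
  intro τ hτ
  have hB : 0 < pB := hA.trans hAB
  have := isProbabilityMeasure_expMeasure hA
  have := isProbabilityMeasure_expMeasure hB
  have key : ∀ t : ℝ, 0 ≤ t → ℙ {ω | X ω - Y ω > t} =
      ∫⁻ y, ENNReal.ofReal (Real.exp (-(pA * (t + y)))) ∂(expMeasure pB) := by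
    intro t ht
    have hm := (indepFun_iff_map_prod_eq_prod_map_map hX.aemeasurable hY.aemeasurable).1 hXY
    rw [hXd, hYd] at hm
    have hs : MeasurableSet {p : ℝ × ℝ | t < p.1 - p.2} :=
      measurableSet_lt measurable_const (measurable_fst.sub measurable_snd)
    have h1 : ℙ {ω | X ω - Y ω > t} =
        (Measure.map (fun ω => (X ω, Y ω)) ℙ) {p : ℝ × ℝ | t < p.1 - p.2} := by
      rw [Measure.map_apply (hX.prodMk hY) hs]; rfl
    rw [h1, hm, Measure.prod_apply_symm hs]
    apply lintegral_congr_ae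
    filter_upwards [exp_ae_nonneg hB] with y hy
    rw [← exp_tail hA (add_nonneg ht hy)]
    congr 1
    ext x
    simp [lt_sub_iff_add_lt]
  have hc : 0 ≤ 1 / pA - 1 / pB := sub_nonneg.2 (one_div_le_one_div_of_le hA hAB.le)
  rw [key _ (by linarith), key _ hτ.le, ← lintegral_mul_const _ (by fun_prop)]
  congr 1
  ext1 y
  rw [← ENNReal.ofReal_mul (Real.exp_pos _).le, ← Real.exp_add]
  congr 2
  field_simp
  ring
end

section
/- Let X and Y be independent random variables where X has the exponential distribution with rate p_A > 0 and Y has the exponential distribution with rate p_B > 0, and let τ > 0. If p_A < p_B then P(X − Y > τ) > P(X − Y > τ + 1/p_A − 1/p_B), and if p_A > p_B then P(X − Y > τ) < P(X − Y > τ + 1/p_A − 1/p_B). -/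
open MeasureTheory ProbabilityTheory

lemma expMeasure_Ioo_pos {r a b : ℝ} (hr : 0 < r) (ha : 0 ≤ a) (hab : a < b) :
    expMeasure r (Set.Ioo a b) ≠ 0 := by
  unfold expMeasure gammaMeasure
  have hm : Measurable (gammaPDF 1 r) := (measurable_gammaPDFReal 1 r).ennreal_ofReal
  rw [Ne, withDensity_apply_eq_zero hm]
  have : {x | gammaPDF 1 r x ≠ 0} ∩ Set.Ioo a b = Set.Ioo a b := by
    apply Set.inter_eq_right.mpr
    intro x hx
    have := gammaPDFReal_pos one_pos hr (lt_of_le_of_lt ha hx.1)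
    simpa [gammaPDF] using this
  rw [this, Real.volume_Ioo]
  simpa using hab

lemma strict_tail {Ω : Type*} [MeasureSpace Ω] [IsProbabilityMeasure (ℙ : Measure Ω)]
    (pA pB : ℝ) (hA : 0 < pA) (hB : 0 < pB)
    (X Y : Ω → ℝ) (hX : Measurable X) (hY : Measurable Y)
    (hXY : IndepFun X Y ℙ)
    (hXd : Measure.map X ℙ = expMeasure pA)
    (hYd : Measure.map Y ℙ = expMeasure pB) (s t : ℝ) (hst : s < t) :
    ℙ {ω | X ω - Y ω > t} < ℙ {ω | X ω - Y ω > s} := by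
  have h1 := neg_abs_le s
  have h0 := abs_nonneg s
  set c := |s|
  have hI := hXY.measure_inter_preimage_eq_mul (Set.Ioo (s + (c + (t - s) / 2)) (t + c))
    (Set.Ioo c (c + (t - s) / 2)) measurableSet_Ioo measurableSet_Ioo
  rw [← Measure.map_apply hX measurableSet_Ioo, ← Measure.map_apply hY measurableSet_Ioo,
    hXd, hYd] at hI
  set E := X ⁻¹' (Set.Ioo (s + (c + (t - s) / 2)) (t + c)) ∩ Y ⁻¹' (Set.Ioo c (c + (t - s) / 2))
    with hE
  have hpos : ℙ E ≠ 0 := by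
    rw [hI]
    exact mul_ne_zero (expMeasure_Ioo_pos hA (by linarith) (by linarith))
      (expMeasure_Ioo_pos hB h0 (by linarith))
  have hEm : MeasurableSet E := (hX measurableSet_Ioo).inter (hY measurableSet_Ioo)
  have hd : Disjoint {ω | X ω - Y ω > t} E := by
    rw [Set.disjoint_left]
    rintro ω h ⟨⟨_, h2⟩, ⟨h3, _⟩⟩
    simp only [Set.mem_setOf_eq] at h
    linarith
  calc ℙ {ω | X ω - Y ω > t} < ℙ {ω | X ω - Y ω > t} + ℙ E :=
        ENNReal.lt_add_right (measure_ne_top _ _) hpos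
    _ = ℙ ({ω | X ω - Y ω > t} ∪ E) := (measure_union hd hEm).symm
    _ ≤ _ := by
        apply measure_mono
        rintro ω (h | ⟨⟨h2, _⟩, ⟨_, h3⟩⟩)
        · exact lt_trans hst h
        · simp only [Set.mem_setOf_eq]
          linarith

/-- If `X` and `Y` are independent exponential random variables with rates `pA` and `pB`
and `τ > 0`, then the error probability of the method-of-moments estimator,
`P(X − Y > τ + 1/pA − 1/pB)`, is smaller than the naive error probability `P(X − Y > τ)`
when `pA < pB`, and larger when `pA > pB`. -/
theorem stmt_7 {Ω : Type*} [MeasureSpace Ω] [IsProbabilityMeasure (ℙ : Measure Ω)]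
    (pA pB : ℝ) (hA : 0 < pA) (hB : 0 < pB)
    (X Y : Ω → ℝ) (hX : Measurable X) (hY : Measurable Y)
    (hXY : IndepFun X Y ℙ)
    (hXd : Measure.map X ℙ = expMeasure pA)
    (hYd : Measure.map Y ℙ = expMeasure pB)
    (τ : ℝ) (hτ : 0 < τ) :
    (pA < pB →
      ℙ {ω | X ω - Y ω > τ + 1 / pA - 1 / pB} < ℙ {ω | X ω - Y ω > τ}) ∧
    (pB < pA →
      ℙ {ω | X ω - Y ω > τ} < ℙ {ω | X ω - Y ω > τ + 1 / pA - 1 / pB}) := by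
  constructor
  · intro h
    have := one_div_lt_one_div_of_lt hA h
    exact strict_tail pA pB hA hB X Y hX hY hXY hXd hYd _ _ (by linarith)
  · intro h
    have := one_div_lt_one_div_of_lt hB h
    exact strict_tail pA pB hA hB X Y hX hY hXY hXd hYd _ _ (by linarith)
end

section
/- Let n ≥ 2 be an integer, let t₀, δ₀, δ₁, …, δ_{n−1} be real numbers, and define t_i = t₀ + Σ_{j=0}^{i−1} δ_j for i = 1, …, n. Then (1/n)·Σ_{i=1}^{n} i·t_i − ((1/n)·Σ_{i=1}^{n} i)·((1/n)·Σ_{i=1}^{n} t_i) = Σ_{i=1}^{n−1} (i(n−i)/(2n))·δ_i, and (1/n)·Σ_{i=1}^{n} i² − ((1/n)·Σ_{i=1}^{n} i)² = (n²−1)/12. Consequently the least-squares slope β̂ = ((1/n)Σ i·t_i − ī·t̄)/((1/n)Σ i² − ī²) equals Σ_{i=1}^{n−1} (6i(n−i)/(n(n²−1)))·δ_i when n ≥ 2. -/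
lemma aux_S1 (n : ℕ) : ∑ i ∈ Finset.Icc 1 n, (i : ℝ) = n * (n + 1) / 2 := by
  induction n with
  | zero => simp
  | succ k ih => rw [Finset.sum_Icc_succ_top (by omega), ih]; push_cast; ring

lemma aux_S2 (n : ℕ) : ∑ i ∈ Finset.Icc 1 n, (i : ℝ) ^ 2 = n * (n + 1) * (2 * n + 1) / 6 := by
  induction n with
  | zero => simp
  | succ k ih => rw [Finset.sum_Icc_succ_top (by omega), ih]; push_cast; ring

lemma aux_T (t₀ : ℝ) (δ : ℕ → ℝ) (n : ℕ) :
    ∑ i ∈ Finset.Icc 1 n, (t₀ + ∑ j ∈ Finset.range i, δ j) =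
      n * t₀ + n * ∑ j ∈ Finset.range n, δ j - ∑ j ∈ Finset.range n, (j : ℝ) * δ j := by
  induction n with
  | zero => simp
  | succ k ih =>
    rw [Finset.sum_Icc_succ_top (by omega), ih]
    simp only [Finset.sum_range_succ]; push_cast; ring

lemma aux_IT (t₀ : ℝ) (δ : ℕ → ℝ) (n : ℕ) :
    ∑ i ∈ Finset.Icc 1 n, (i : ℝ) * (t₀ + ∑ j ∈ Finset.range i, δ j) =
      n * (n + 1) / 2 * (t₀ + ∑ j ∈ Finset.range n, δ j)
      - (∑ j ∈ Finset.range n, (j : ℝ) ^ 2 * δ j + ∑ j ∈ Finset.range n, (j : ℝ) * δ j) / 2 := by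
  induction n with
  | zero => simp
  | succ k ih =>
    rw [Finset.sum_Icc_succ_top (by omega), ih]
    simp only [Finset.sum_range_succ]; push_cast; ring

lemma aux_R (δ : ℕ → ℝ) (c : ℝ) (n : ℕ) (hn : 1 ≤ n) :
    ∑ i ∈ Finset.Ico 1 n, ((i : ℝ) * (c - (i : ℝ)) / (2 * c)) * δ i =
      (c * ∑ j ∈ Finset.range n, (j : ℝ) * δ j
        - ∑ j ∈ Finset.range n, (j : ℝ) ^ 2 * δ j) / (2 * c) := by
  induction n, hn using Nat.le_induction with
  | base => simp
  | succ k hk ih =>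
    rw [Finset.sum_Ico_succ_top hk, ih]
    simp only [Finset.sum_range_succ]; ring

/-- Let `tᵢ = t₀ + Σ_{j=0}^{i−1} δⱼ` for `i = 1, …, n`. Then the numerator of the
least-squares slope equals `Σ_{i=1}^{n−1} (i(n−i)/(2n))·δᵢ`, its denominator equals
`(n²−1)/12`, and consequently the least-squares slope `β̂` equals
`Σ_{i=1}^{n−1} (6i(n−i)/(n(n²−1)))·δᵢ`. -/
theorem stmt_13 (n : ℕ) (hn : 2 ≤ n) (t₀ : ℝ) (δ : ℕ → ℝ) (t : ℕ → ℝ)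
    (ht : ∀ i, 1 ≤ i → i ≤ n → t i = t₀ + ∑ j ∈ Finset.range i, δ j) :
    ((1 / (n : ℝ)) * ∑ i ∈ Finset.Icc 1 n, (i : ℝ) * t i -
        ((1 / (n : ℝ)) * ∑ i ∈ Finset.Icc 1 n, (i : ℝ)) *
          ((1 / (n : ℝ)) * ∑ i ∈ Finset.Icc 1 n, t i) =
      ∑ i ∈ Finset.Ico 1 n, ((i : ℝ) * ((n : ℝ) - (i : ℝ)) / (2 * (n : ℝ))) * δ i) ∧
    ((1 / (n : ℝ)) * ∑ i ∈ Finset.Icc 1 n, (i : ℝ) ^ 2 -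
        ((1 / (n : ℝ)) * ∑ i ∈ Finset.Icc 1 n, (i : ℝ)) ^ 2 = ((n : ℝ) ^ 2 - 1) / 12) ∧
    ((1 / (n : ℝ)) * ∑ i ∈ Finset.Icc 1 n, (i : ℝ) * t i -
        ((1 / (n : ℝ)) * ∑ i ∈ Finset.Icc 1 n, (i : ℝ)) *
          ((1 / (n : ℝ)) * ∑ i ∈ Finset.Icc 1 n, t i)) /
      ((1 / (n : ℝ)) * ∑ i ∈ Finset.Icc 1 n, (i : ℝ) ^ 2 -
        ((1 / (n : ℝ)) * ∑ i ∈ Finset.Icc 1 n, (i : ℝ)) ^ 2) =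
      ∑ i ∈ Finset.Ico 1 n,
        (6 * (i : ℝ) * ((n : ℝ) - (i : ℝ)) / ((n : ℝ) * ((n : ℝ) ^ 2 - 1))) * δ i := by
  have hn0 : (n : ℝ) ≠ 0 := by positivity
  have hn2 : (2 : ℝ) ≤ n := by exact_mod_cast hn
  have hd : (n : ℝ) ^ 2 - 1 ≠ 0 := by nlinarith
  have e1 : ∑ i ∈ Finset.Icc 1 n, t i =
      ∑ i ∈ Finset.Icc 1 n, (t₀ + ∑ j ∈ Finset.range i, δ j) :=
    Finset.sum_congr rfl fun i hi => ht i (Finset.mem_Icc.1 hi).1 (Finset.mem_Icc.1 hi).2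
  have e2 : ∑ i ∈ Finset.Icc 1 n, (i : ℝ) * t i =
      ∑ i ∈ Finset.Icc 1 n, (i : ℝ) * (t₀ + ∑ j ∈ Finset.range i, δ j) :=
    Finset.sum_congr rfl fun i hi => by
      rw [ht i (Finset.mem_Icc.1 hi).1 (Finset.mem_Icc.1 hi).2]
  have A : (1 / (n : ℝ)) * ∑ i ∈ Finset.Icc 1 n, (i : ℝ) * t i -
        ((1 / (n : ℝ)) * ∑ i ∈ Finset.Icc 1 n, (i : ℝ)) *
          ((1 / (n : ℝ)) * ∑ i ∈ Finset.Icc 1 n, t i) =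
      ∑ i ∈ Finset.Ico 1 n, ((i : ℝ) * ((n : ℝ) - (i : ℝ)) / (2 * (n : ℝ))) * δ i := by
    rw [e1, e2, aux_T, aux_IT, aux_S1, aux_R δ n n (by omega)]
    field_simp
    ring
  have B : (1 / (n : ℝ)) * ∑ i ∈ Finset.Icc 1 n, (i : ℝ) ^ 2 -
        ((1 / (n : ℝ)) * ∑ i ∈ Finset.Icc 1 n, (i : ℝ)) ^ 2 = ((n : ℝ) ^ 2 - 1) / 12 := by
    rw [aux_S1, aux_S2]
    field_simp
    ring
  refine ⟨A, B, ?_⟩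
  rw [A, B, Finset.sum_div]
  refine Finset.sum_congr rfl fun i _ => ?_
  field_simp
  ring
end

section
/- For every integer n ≥ 3 and every real p with 0 < p < 1/2, both (1−p)/(p²(n−1)) < (1−p)²/p² and 6(n²+1)(1−p)/(5n(n²−1)p²) < (1−p)²/p²; moreover (1−p)/(p²(n−1)) ≤ 6(n²+1)(1−p)/(5n(n²−1)p²), with strict inequality whenever n ≥ 4. -/
/-- For `n ≥ 3` and `0 < p < 1/2`, the MSEs of the method-of-moments and linear
regression estimators of `μ = 1/p` are both smaller than the MSE `(1−p)²/p²` of the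
naive estimator, and the method-of-moments MSE is at most the linear regression MSE,
strictly so when `n ≥ 4`. -/
theorem stmt_18 (n : ℕ) (hn : 3 ≤ n) (p : ℝ) (hp0 : 0 < p) (hp1 : p < 1 / 2) :
    ((1 - p) / (p ^ 2 * ((n : ℝ) - 1)) < (1 - p) ^ 2 / p ^ 2) ∧
    (6 * ((n : ℝ) ^ 2 + 1) * (1 - p) / (5 * (n : ℝ) * ((n : ℝ) ^ 2 - 1) * p ^ 2) <
      (1 - p) ^ 2 / p ^ 2) ∧
    ((1 - p) / (p ^ 2 * ((n : ℝ) - 1)) ≤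
      6 * ((n : ℝ) ^ 2 + 1) * (1 - p) / (5 * (n : ℝ) * ((n : ℝ) ^ 2 - 1) * p ^ 2)) ∧
    (4 ≤ n →
      (1 - p) / (p ^ 2 * ((n : ℝ) - 1)) <
        6 * ((n : ℝ) ^ 2 + 1) * (1 - p) / (5 * (n : ℝ) * ((n : ℝ) ^ 2 - 1) * p ^ 2)) := by
  have hx : (3 : ℝ) ≤ n := by exact_mod_cast hn
  have hx4 : 4 ≤ n → (4 : ℝ) ≤ n := fun h => by exact_mod_cast h
  generalize (n : ℝ) = x at hx hx4 ⊢
  have h1 : 0 < x - 1 := by linarith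
  have h2 : 0 < x ^ 2 - 1 := by nlinarith
  have h0 : 0 < x := by linarith
  have hK : 0 < (1 - p) / p ^ 2 := div_pos (by linarith) (by positivity)
  have eA : (1 - p) / (p ^ 2 * (x - 1)) = (1 / (x - 1)) * ((1 - p) / p ^ 2) := by
    field_simp
  have eB : 6 * (x ^ 2 + 1) * (1 - p) / (5 * x * (x ^ 2 - 1) * p ^ 2)
      = (6 * (x ^ 2 + 1) / (5 * x * (x ^ 2 - 1))) * ((1 - p) / p ^ 2) := by
    rw [div_mul_div_comm]
  have eN : (1 - p) ^ 2 / p ^ 2 = (1 - p) * ((1 - p) / p ^ 2) := by ring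
  rw [eA, eB, eN]
  have hd : 0 < 5 * x * (x ^ 2 - 1) := by positivity
  have a1 : 1 / (x - 1) ≤ 1 / 2 := by
    rw [div_le_div_iff₀ h1 (by norm_num)]; linarith
  have b1 : 6 * (x ^ 2 + 1) / (5 * x * (x ^ 2 - 1)) ≤ 1 / 2 := by
    rw [div_le_div_iff₀ hd (by norm_num)]
    have : 0 ≤ (x - 3) * (5 * x ^ 2 + 3 * x + 4) :=
      mul_nonneg (by linarith) (by positivity)
    linarith
  have key : 6 * (x ^ 2 + 1) / (5 * x * (x ^ 2 - 1)) - 1 / (x - 1)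
      = (x - 2) * (x - 3) / (5 * x * (x ^ 2 - 1)) := by
    have e : x ^ 2 - 1 = (x - 1) * (x + 1) := by ring
    have h3 : x + 1 ≠ 0 := by linarith
    rw [e]
    field_simp
    ring
  refine ⟨mul_lt_mul_of_pos_right (by linarith) hK, mul_lt_mul_of_pos_right (by linarith) hK,
    mul_le_mul_of_nonneg_right ?_ hK.le, fun h => mul_lt_mul_of_pos_right ?_ hK⟩
  · have : 0 ≤ (x - 2) * (x - 3) / (5 * x * (x ^ 2 - 1)) :=
      div_nonneg (mul_nonneg (by linarith) (by linarith)) hd.le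
    linarith
  · have := hx4 h
    have : 0 < (x - 2) * (x - 3) / (5 * x * (x ^ 2 - 1)) :=
      div_pos (mul_pos (by linarith) (by linarith)) hd
    linarith
end

section
/- For every integer n ≥ 4 and every real p with 0 < p < 1/2, both ((1−p)/p²)·(n/(n−1)) < (1−p)(2−p)/p² and ((1−p)/p²)·((5n³+6n²−5n+6)/(5n(n²−1))) < (1−p)(2−p)/p²; moreover n/(n−1) ≤ (5n³+6n²−5n+6)/(5n(n²−1)), with strict inequality whenever n ≥ 4. -/
/-- For `n ≥ 4` and `0 < p < 1/2`, the MSEs of the method-of-moments and linear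
regression estimators of the host infection time `t₀` are both smaller than the MSE
`(1−p)(2−p)/p²` of the naive estimator, and `n/(n−1) ≤ (5n³+6n²−5n+6)/(5n(n²−1))`,
strictly so when `n ≥ 4`. -/
theorem stmt_19 (n : ℕ) (hn : 4 ≤ n) (p : ℝ) (hp0 : 0 < p) (hp1 : p < 1 / 2) :
    (((1 - p) / p ^ 2) * ((n : ℝ) / ((n : ℝ) - 1)) < (1 - p) * (2 - p) / p ^ 2) ∧
    (((1 - p) / p ^ 2) *
        ((5 * (n : ℝ) ^ 3 + 6 * (n : ℝ) ^ 2 - 5 * (n : ℝ) + 6) /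
          (5 * (n : ℝ) * ((n : ℝ) ^ 2 - 1))) < (1 - p) * (2 - p) / p ^ 2) ∧
    ((n : ℝ) / ((n : ℝ) - 1) ≤
      (5 * (n : ℝ) ^ 3 + 6 * (n : ℝ) ^ 2 - 5 * (n : ℝ) + 6) /
        (5 * (n : ℝ) * ((n : ℝ) ^ 2 - 1))) ∧
    (4 ≤ n →
      (n : ℝ) / ((n : ℝ) - 1) <
        (5 * (n : ℝ) ^ 3 + 6 * (n : ℝ) ^ 2 - 5 * (n : ℝ) + 6) /
          (5 * (n : ℝ) * ((n : ℝ) ^ 2 - 1))) := by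
  have hx : (4 : ℝ) ≤ (n : ℝ) := by exact_mod_cast hn
  generalize (n : ℝ) = x at hx ⊢
  have h1 : 0 < x - 1 := by linarith
  have h2 : 0 < x ^ 2 - 1 := by nlinarith
  have h3 : 0 < 5 * x * (x ^ 2 - 1) := by positivity
  have hlt : x / (x - 1) <
      (5 * x ^ 3 + 6 * x ^ 2 - 5 * x + 6) / (5 * x * (x ^ 2 - 1)) := by
    rw [div_lt_div_iff₀ h1 h3]
    have h4 : 0 < (x - 1) * ((x - 2) * (x - 3)) :=
      mul_pos h1 (mul_pos (by linarith) (by linarith))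
    nlinarith
  have hle : (5 * x ^ 3 + 6 * x ^ 2 - 5 * x + 6) / (5 * x * (x ^ 2 - 1)) < 2 - p := by
    have : (5 * x ^ 3 + 6 * x ^ 2 - 5 * x + 6) / (5 * x * (x ^ 2 - 1)) ≤ 3 / 2 := by
      rw [div_le_div_iff₀ h3 (by norm_num)]
      obtain ⟨y, rfl⟩ : ∃ y, x = y + 4 := ⟨x - 4, by ring⟩
      have hy : 0 ≤ y := by linarith
      have h5 : 0 ≤ y ^ 2 := by positivity
      have h6 : 0 ≤ y ^ 3 := by positivity
      nlinarith
    linarith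
  have hc : 0 < (1 - p) / p ^ 2 := div_pos (by linarith) (by positivity)
  have he : (1 - p) * (2 - p) / p ^ 2 = (1 - p) / p ^ 2 * (2 - p) := by ring
  rw [he]
  exact ⟨mul_lt_mul_of_pos_left (hlt.trans hle) hc, mul_lt_mul_of_pos_left hle hc,
    hlt.le, fun _ => hlt⟩
end
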